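/- Fix h ∈ ℝ and four pairwise distinct site indices i, j, k, l. For Lebesgue-almost every J ∈ [0,∞), the four-point correlation function factorizes into two-point functions in the thermodynamic limit: lim_{N→∞, N > max(i,j,k,l)} ( ω_N(σ_i·σ_j·σ_k·σ_l) − ω_N(σ_i·σ_j)·ω_N(σ_k·σ_l) ) = 0. -/

import Mathlib

open Filter MeasureTheory

noncomputable section

/-- The value of a spin encoded by a Boolean: `+1` or `-1`. -/
def spin (b : Bool) : ℝ := if b then 1 else -1

/-- Magnetization of a configuration of `N` spins. -/
def mag (N : ℕ) (σ : Fin N → Bool) : ℝ := (∑ i, spin (σ i)) / N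

/-- Curie-Weiss Hamiltonian. -/
def ham (N : ℕ) (J h : ℝ) (σ : Fin N → Bool) : ℝ :=
  -(N * (J / 2 * mag N σ ^ 2 + h * mag N σ))

/-- Curie-Weiss partition function. -/
def Z (N : ℕ) (J h : ℝ) : ℝ := ∑ σ : Fin N → Bool, Real.exp (-ham N J h σ)

/-- Gibbs expectation of an observable `f`. -/
def gibbs (N : ℕ) (J h : ℝ) (f : (Fin N → Bool) → ℝ) : ℝ :=
  (∑ σ : Fin N → Bool, f σ * Real.exp (-ham N J h σ)) / Z N J h

/-- The spin observable at site `i` in a system of `N` spins (a junk value `0` is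
used when `i ≥ N`; this only affects finitely many `N`, hence not the limit). -/
def spinAt (N i : ℕ) (σ : Fin N → Bool) : ℝ :=
  if hi : i < N then spin (σ ⟨i, hi⟩) else 0


lemma spin_abs (b : Bool) : |spin b| = 1 := by cases b <;> simp [spin]

lemma Z_pos (N : ℕ) (J h : ℝ) : 0 < Z N J h := by
  unfold Z
  exact Finset.sum_pos (fun _ _ => Real.exp_pos _) Finset.univ_nonempty

lemma gibbs_mono {N : ℕ} {J h : ℝ} {f g : (Fin N → Bool) → ℝ} (hfg : ∀ σ, f σ ≤ g σ) :
    gibbs N J h f ≤ gibbs N J h g := by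
  unfold gibbs
  have := Z_pos N J h
  gcongr with σ
  exact hfg σ

lemma gibbs_const (N : ℕ) (J h c : ℝ) : gibbs N J h (fun _ => c) = c := by
  unfold gibbs
  rw [← Finset.mul_sum]
  exact mul_div_cancel_right₀ _ (Z_pos N J h).ne'

lemma gibbs_add (N : ℕ) (J h : ℝ) (f g : (Fin N → Bool) → ℝ) :
    gibbs N J h (fun σ => f σ + g σ) = gibbs N J h f + gibbs N J h g := by
  simp only [gibbs, add_mul, Finset.sum_add_distrib, add_div]

lemma gibbs_smul (N : ℕ) (J h c : ℝ) (f : (Fin N → Bool) → ℝ) :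
    gibbs N J h (fun σ => c * f σ) = c * gibbs N J h f := by
  simp only [gibbs, mul_assoc, ← Finset.mul_sum, mul_div_assoc]

lemma gibbs_sub (N : ℕ) (J h : ℝ) (f g : (Fin N → Bool) → ℝ) :
    gibbs N J h (fun σ => f σ - g σ) = gibbs N J h f - gibbs N J h g := by
  simp only [gibbs, sub_mul, Finset.sum_sub_distrib, sub_div]

lemma gibbs_sum (N : ℕ) (J h : ℝ) {ι : Type} (s : Finset ι) (f : ι → (Fin N → Bool) → ℝ) :
    gibbs N J h (fun σ => ∑ a ∈ s, f a σ) = ∑ a ∈ s, gibbs N J h (f a) := by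
  simp only [gibbs, Finset.sum_mul]
  rw [Finset.sum_comm, Finset.sum_div]

lemma gibbs_abs_le (N : ℕ) (J h : ℝ) (f : (Fin N → Bool) → ℝ) :
    |gibbs N J h f| ≤ gibbs N J h (fun σ => |f σ|) := by
  rw [abs_le]
  constructor
  · have := gibbs_mono (N := N) (J := J) (h := h) (f := fun σ => (-1) * |f σ|) (g := f)
      (fun σ => by linarith [neg_abs_le (f σ)])
    rw [gibbs_smul] at this
    linarith
  · exact gibbs_mono (fun σ => le_abs_self _)

lemma gibbs_abs_le_one {N : ℕ} {J h : ℝ} {f : (Fin N → Bool) → ℝ} (hf : ∀ σ, |f σ| ≤ 1) :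
    |gibbs N J h f| ≤ 1 :=
  (gibbs_abs_le N J h f).trans ((gibbs_mono hf).trans_eq (gibbs_const N J h 1))

lemma mag_perm {N : ℕ} (e : Equiv.Perm (Fin N)) (σ : Fin N → Bool) :
    mag N (σ ∘ e) = mag N σ := by
  unfold mag
  congr 1
  exact Equiv.sum_comp e (fun i => spin (σ i))

lemma gibbs_perm {N : ℕ} (J h : ℝ) (e : Equiv.Perm (Fin N)) (f : (Fin N → Bool) → ℝ) :
    gibbs N J h (fun σ => f (σ ∘ e)) = gibbs N J h f := by
  unfold gibbs
  congr 1
  refine Fintype.sum_equiv (Equiv.arrowCongr e.symm (Equiv.refl Bool)) _ _ ?_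
  intro σ
  have : (Equiv.arrowCongr e.symm (Equiv.refl Bool)) σ = σ ∘ e := by
    ext x; simp [Equiv.arrowCongr]
  rw [this]
  simp only [ham, mag_perm]

lemma exists_perm {N : ℕ} {i j k l a b : Fin N} (hij : i ≠ j) (hik : i ≠ k) (hil : i ≠ l)
    (hjk : j ≠ k) (hjl : j ≠ l) (hab : a ≠ b) (hak : a ≠ k) (hal : a ≠ l) (hbk : b ≠ k)
    (hbl : b ≠ l) : ∃ e : Equiv.Perm (Fin N), e i = a ∧ e j = b ∧ e k = k ∧ e l = l := by
  refine ⟨(Equiv.swap i a).trans (Equiv.swap (Equiv.swap i a j) b), ?_, ?_, ?_, ?_⟩ <;>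
    simp only [Equiv.trans_apply, Equiv.swap_apply_def] <;> grind

lemma mag_abs (N : ℕ) (σ : Fin N → Bool) : |mag N σ| ≤ 1 := by
  unfold mag
  rw [abs_div, Nat.abs_cast]
  apply div_le_one_of_le₀ _ (Nat.cast_nonneg N)
  refine (Finset.abs_sum_le_sum_abs _ _).trans ?_
  simp [spin_abs]

/-- Replacing `σ_i σ_j` by `m²` costs `10/N`. -/
lemma replace_mag {N : ℕ} (hN : 0 < N) (J h : ℝ) {i j k l : Fin N} (hij : i ≠ j) (hik : i ≠ k)
    (hil : i ≠ l) (hjk : j ≠ k) (hjl : j ≠ l) (G : ℝ → ℝ → ℝ)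
    (hG : ∀ b c : Bool, |G (spin b) (spin c)| ≤ 1) :
    |gibbs N J h (fun σ => mag N σ ^ 2 * G (spin (σ k)) (spin (σ l)))
      - gibbs N J h (fun σ => spin (σ i) * spin (σ j) * G (spin (σ k)) (spin (σ l)))|
      ≤ 10 / N := by
  have hN' : (0 : ℝ) < N := by exact_mod_cast hN
  set q : Fin N → Fin N → ℝ := fun a b =>
    gibbs N J h (fun σ => spin (σ a) * spin (σ b) * G (spin (σ k)) (spin (σ l))) with hq
  have hq1 : ∀ a b, |q a b| ≤ 1 := by
    intro a b
    apply gibbs_abs_le_one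
    intro σ
    rw [abs_mul, abs_mul, spin_abs, spin_abs]
    simpa using hG _ _
  have e1 : gibbs N J h (fun σ => mag N σ ^ 2 * G (spin (σ k)) (spin (σ l)))
      = (1 / (N:ℝ)^2) * ∑ a, ∑ b, q a b := by
    simp only [hq]
    simp_rw [← gibbs_sum]
    rw [← gibbs_smul]
    congr 1
    ext σ
    simp only [mag, ← Finset.sum_mul, ← Finset.mul_sum]
    field_simp
  have e2 : q i j = (1 / (N:ℝ)^2) * ∑ a : Fin N, ∑ b : Fin N, q i j := by
    simp
    field_simp
  change |_ - q i j| ≤ _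
  rw [e1, e2, ← mul_sub, ← Finset.sum_sub_distrib]
  simp_rw [← Finset.sum_sub_distrib]
  have key : ∀ a b, |q a b - q i j| ≤ 2 * ((if a = b then 1 else 0) + (if a = k then 1 else 0)
      + (if a = l then 1 else 0) + (if b = k then 1 else 0) + (if b = l then 1 else 0)) := by
    intro a b
    by_cases hgood : a ≠ b ∧ a ≠ k ∧ a ≠ l ∧ b ≠ k ∧ b ≠ l
    · obtain ⟨hab, hak, hal, hbk, hbl⟩ := hgood
      obtain ⟨e, ei, ej, ek, el⟩ := exists_perm hij hik hil hjk hjl hab hak hal hbk hbl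
      have : q a b = q i j := by
        rw [hq]
        dsimp only
        rw [← gibbs_perm J h e (fun σ => spin (σ i) * spin (σ j) * G (spin (σ k)) (spin (σ l)))]
        simp only [Function.comp_apply, ei, ej, ek, el]
      rw [this]
      simp [hab, hak, hal, hbk, hbl]
    · have h2 : |q a b - q i j| ≤ 2 := by
        have := hq1 a b
        have := hq1 i j
        have := abs_sub (q a b) (q i j)
        linarith
      refine h2.trans ?_
      have h0 : ∀ (p : Prop) [Decidable p], (0:ℝ) ≤ if p then 1 else 0 := by
        intro p _; split_ifs <;> norm_num
      have t1 := h0 (a = b)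
      have t2 := h0 (a = k)
      have t3 := h0 (a = l)
      have t4 := h0 (b = k)
      have t5 := h0 (b = l)
      by_cases c1 : a = b
      · rw [if_pos c1] at *; linarith
      by_cases c2 : a = k
      · rw [if_pos c2] at *; linarith
      by_cases c3 : a = l
      · rw [if_pos c3] at *; linarith
      by_cases c4 : b = k
      · rw [if_pos c4] at *; linarith
      by_cases c5 : b = l
      · rw [if_pos c5] at *; linarith
      exact absurd ⟨c1, c2, c3, c4, c5⟩ hgood
  have hs : |∑ a, ∑ b, (q a b - q i j)| ≤ 10 * N := by
    calc |∑ a, ∑ b, (q a b - q i j)| ≤ ∑ a, ∑ b, |q a b - q i j| :=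
          (Finset.abs_sum_le_sum_abs _ _).trans
            (Finset.sum_le_sum fun a _ => Finset.abs_sum_le_sum_abs _ _)
      _ ≤ ∑ a : Fin N, ∑ b : Fin N, 2 * ((if a = b then (1:ℝ) else 0) + (if a = k then 1 else 0)
          + (if a = l then 1 else 0) + (if b = k then 1 else 0) + (if b = l then 1 else 0)) :=
          Finset.sum_le_sum fun a _ => Finset.sum_le_sum fun b _ => key a b
      _ = 10 * N := by
          simp only [← Finset.mul_sum, Finset.sum_add_distrib, Finset.sum_const, Finset.sum_ite_eq,
            Finset.sum_ite_eq', Finset.mem_univ, if_true, Finset.card_univ, Fintype.card_fin,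
            nsmul_eq_mul]
          ring
  rw [abs_mul, abs_of_nonneg (by positivity : (0:ℝ) ≤ 1 / (N:ℝ)^2)]
  calc 1 / (N:ℝ)^2 * |∑ a, ∑ b, (q a b - q i j)| ≤ 1 / (N:ℝ)^2 * (10 * N) := by gcongr
    _ = 10 / (N:ℝ) := by field_simp

lemma ham_eq (N : ℕ) (J h : ℝ) (σ : Fin N → Bool) :
    -ham N J h σ = J / 2 * ((∑ i, spin (σ i)) ^ 2 / N) + h * ∑ i, spin (σ i) := by
  unfold ham mag
  rcases Nat.eq_zero_or_pos N with rfl | hN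
  · simp
  · have : (0 : ℝ) < N := by exact_mod_cast hN
    field_simp

lemma titu (x y : ℝ) {a b : ℝ} (ha : 0 < a) (hb : 0 < b) :
    (x + y) ^ 2 / (a + b) ≤ x ^ 2 / a + y ^ 2 / b := by
  rw [div_add_div _ _ ha.ne' hb.ne', div_le_div_iff₀ (by positivity) (by positivity)]
  nlinarith [sq_nonneg (x * b - y * a), mul_pos ha hb]

lemma Z_zero (J h : ℝ) : Z 0 J h = 1 := by
  simp [Z, ham]

lemma Z_sub {J : ℝ} (hJ : 0 ≤ J) (h : ℝ) (m n : ℕ) :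
    Z (m + n) J h ≤ Z m J h * Z n J h := by
  rcases Nat.eq_zero_or_pos m with rfl | hm
  · rw [Z_zero, one_mul, zero_add]
  rcases Nat.eq_zero_or_pos n with rfl | hn
  · rw [Z_zero, mul_one, add_zero]
  have hm' : (0 : ℝ) < m := by exact_mod_cast hm
  have hn' : (0 : ℝ) < n := by exact_mod_cast hn
  unfold Z
  rw [Finset.sum_mul_sum, ← Fintype.sum_prod_type',
    ← Equiv.sum_comp (Fin.appendEquiv m n)]
  refine Finset.sum_le_sum fun σ _ => ?_
  rw [← Real.exp_add, Real.exp_le_exp, ham_eq, ham_eq, ham_eq]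
  simp only [Fin.appendEquiv, Equiv.coe_fn_mk, Fin.sum_univ_add, Fin.append_left,
    Fin.append_right, Nat.cast_add]
  have := titu (∑ i, spin (σ.1 i)) (∑ i, spin (σ.2 i)) hm' hn'
  nlinarith

/-- Pressure. -/
def pres (h : ℝ) (N : ℕ) (J : ℝ) : ℝ := Real.log (Z N J h) / N

lemma pres_tendsto (h : ℝ) {J : ℝ} (hJ : 0 ≤ J) :
    ∃ p : ℝ, Tendsto (fun N => pres h N J) atTop (nhds p) := by
  have hs : Subadditive (fun N => Real.log (Z N J h)) := by
    intro m n
    rw [← Real.log_mul (Z_pos _ _ _).ne' (Z_pos _ _ _).ne']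
    exact Real.log_le_log (Z_pos _ _ _) (Z_sub hJ h m n)
  refine ⟨hs.lim, hs.tendsto_lim ⟨-|h|, ?_⟩⟩
  rintro _ ⟨N, rfl⟩
  dsimp only
  rcases Nat.eq_zero_or_pos N with rfl | hN
  · simp
  have hN' : (0 : ℝ) < N := by exact_mod_cast hN
  rw [le_div_iff₀ hN', Real.le_log_iff_exp_le (Z_pos _ _ _)]
  unfold Z
  refine le_trans ?_ (Finset.single_le_sum (f := fun σ => Real.exp (-ham N J h σ))
    (fun σ _ => (Real.exp_pos _).le) (Finset.mem_univ (fun _ : Fin N => true)))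
  rw [Real.exp_le_exp]
  simp only [ham, neg_neg]
  have h1 : |h * mag N (fun _ => true)| ≤ |h| := by
    rw [abs_mul]
    exact mul_le_of_le_one_right (abs_nonneg h) (mag_abs _ _)
  have h2 := (abs_le.1 h1).1
  have h3 : 0 ≤ J / 2 * mag N (fun _ => true) ^ 2 := by positivity
  nlinarith

lemma pres_mono (h : ℝ) (N : ℕ) : Monotone (pres h N) := by
  intro J K hJK
  unfold pres
  gcongr
  · exact Z_pos _ _ _
  · unfold Z ham
    simp only [neg_neg]
    gcongr

lemma gibbs_exp {N : ℕ} (hN : 0 < N) (J h t b : ℝ) :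
    gibbs N J h (fun σ => Real.exp (N * t * (mag N σ ^ 2 / 2 - b)))
      = Real.exp (N * (pres h N (J + t) - pres h N J - t * b)) := by
  have hN' : (0 : ℝ) < N := by exact_mod_cast hN
  have e : (N * (pres h N (J + t) - pres h N J - t * b) : ℝ)
      = Real.log (Z N (J + t) h) - Real.log (Z N J h) - N * t * b := by
    unfold pres; field_simp
  rw [e, Real.exp_sub, Real.exp_sub, Real.exp_log (Z_pos _ _ _), Real.exp_log (Z_pos _ _ _)]
  unfold gibbs
  rw [div_right_comm]
  congr 1
  rw [eq_div_iff (Real.exp_pos _).ne', Finset.sum_mul]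
  conv_rhs => unfold Z
  refine Finset.sum_congr rfl fun σ _ => ?_
  rw [← Real.exp_add, ← Real.exp_add]
  congr 1
  unfold ham
  ring

lemma gibbs_exp_tendsto {h J t b P Q : ℝ}
    (hP : Tendsto (fun N => pres h N (J + t)) atTop (nhds P))
    (hQ : Tendsto (fun N => pres h N J) atTop (nhds Q)) (hlt : P - Q - t * b < 0) :
    Tendsto (fun N : ℕ => gibbs N J h (fun σ => Real.exp (N * t * (mag N σ ^ 2 / 2 - b))))
      atTop (nhds 0) := by
  have h1 : Tendsto (fun N : ℕ => (N : ℝ) * (pres h N (J + t) - pres h N J - t * b)) atTop atBot :=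
    tendsto_natCast_atTop_atTop.atTop_mul_neg hlt ((hP.sub hQ).sub_const _)
  refine (Real.tendsto_exp_atBot.comp h1).congr' ?_
  filter_upwards [eventually_gt_atTop 0] with N hN
  rw [gibbs_exp hN]
  rfl

lemma concentration {h J a : ℝ} (hJ : 0 < J) (p : ℝ → ℝ)
    (hp : ∀ K, 0 < K → Tendsto (fun N => pres h N K) atTop (nhds (p K)))
    (hd : HasDerivAt p a J) :
    Tendsto (fun N : ℕ => gibbs N J h (fun σ => |mag N σ ^ 2 / 2 - a|)) atTop (nhds 0) := by
  have hnn : ∀ N : ℕ, 0 ≤ gibbs N J h (fun σ => |mag N σ ^ 2 / 2 - a|) := fun N =>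
    (gibbs_const N J h 0).symm.le.trans (gibbs_mono fun σ => abs_nonneg _)
  rw [Metric.tendsto_atTop']
  intro ε' hε'
  obtain ⟨ε, hε, rfl⟩ : ∃ ε > 0, ε' = 2 * ε := ⟨ε' / 2, by linarith, by ring⟩
  rw [hasDerivAt_iff_isLittleO_nhds_zero] at hd
  have hev := hd.def (half_pos hε)
  obtain ⟨δ, hδ, hδ'⟩ := Metric.eventually_nhds_iff.1 hev
  obtain ⟨s, hs, hsδ, hsJ⟩ : ∃ s > 0, s < δ ∧ s < J :=
    ⟨min δ J / 2, by positivity, by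
      have := min_le_left δ J; have := lt_min hδ hJ; linarith, by
      have := min_le_right δ J; have := lt_min hδ hJ; linarith⟩
  have k1 := hδ' (y := s) (by simpa [abs_of_pos hs] using hsδ)
  have k2 := hδ' (y := -s) (by simpa [abs_of_pos hs] using hsδ)
  simp only [Real.norm_eq_abs, abs_neg, abs_of_pos hs, smul_eq_mul] at k1 k2
  have k1' := (abs_le.1 k1).2
  have k2' := (abs_le.1 k2).2
  have hεs := mul_pos hε hs
  have T1 := gibbs_exp_tendsto (h := h) (b := a + ε) (hp (J + s) (by linarith)) (hp J hJ)
    (by nlinarith)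
  have T2 := gibbs_exp_tendsto (h := h) (b := a - ε) (hp (J + -s) (by linarith)) (hp J hJ)
    (by nlinarith)
  have T3 := (T1.add T2).const_mul (1 + |a|)
  rw [add_zero, mul_zero] at T3
  obtain ⟨M, hM⟩ := eventually_atTop.1 (T3.eventually_lt_const hε)
  refine ⟨M, fun N hN => ?_⟩
  have hlt := hM N hN.le
  rw [Real.dist_eq, sub_zero, abs_of_nonneg (hnn N)]
  have hb : gibbs N J h (fun σ => |mag N σ ^ 2 / 2 - a|) ≤
      gibbs N J h (fun σ => ε + (1 + |a|) * (Real.exp (N * s * (mag N σ ^ 2 / 2 - (a + ε)))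
        + Real.exp (N * (-s) * (mag N σ ^ 2 / 2 - (a - ε))))) := by
    apply gibbs_mono
    intro σ
    have hm0 : 0 ≤ mag N σ ^ 2 := sq_nonneg _
    have hm1 : mag N σ ^ 2 ≤ 1 := by
      rw [sq_le_one_iff_abs_le_one]; exact mag_abs N σ
    generalize mag N σ ^ 2 = x at *
    have hC : |x / 2 - a| ≤ 1 + |a| := by
      refine (abs_sub _ _).trans ?_
      rw [abs_of_nonneg (by positivity : 0 ≤ x / 2)]
      linarith
    have hNs : 0 ≤ (N : ℝ) * s := by positivity
    have p1 := Real.exp_pos (N * s * (x / 2 - (a + ε)))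
    have p2 := Real.exp_pos (N * (-s) * (x / 2 - (a - ε)))
    have ha := abs_nonneg a
    by_cases c1 : a + ε ≤ x / 2
    · have : 1 ≤ Real.exp (N * s * (x / 2 - (a + ε))) :=
        Real.one_le_exp (mul_nonneg hNs (by linarith))
      nlinarith
    by_cases c2 : x / 2 ≤ a - ε
    · have : 1 ≤ Real.exp (N * (-s) * (x / 2 - (a - ε))) :=
        Real.one_le_exp (by nlinarith)
      nlinarith
    have : |x / 2 - a| ≤ ε := abs_le.2 ⟨by linarith, by linarith⟩
    have : 0 ≤ (1 + |a|) * (Real.exp (N * s * (x / 2 - (a + ε)))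
      + Real.exp (N * (-s) * (x / 2 - (a - ε)))) := by positivity
    linarith
  rw [gibbs_add, gibbs_const, gibbs_smul, gibbs_add] at hb
  linarith

lemma fourPoint_bound {N : ℕ} (hN : 0 < N) (J h a : ℝ) {i j k l : Fin N} (hij : i ≠ j)
    (hik : i ≠ k) (hil : i ≠ l) (hjk : j ≠ k) (hjl : j ≠ l) :
    |gibbs N J h (fun σ => spin (σ i) * spin (σ j) * spin (σ k) * spin (σ l))
      - gibbs N J h (fun σ => spin (σ i) * spin (σ j))
        * gibbs N J h (fun σ => spin (σ k) * spin (σ l))|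
      ≤ 20 / N + 4 * gibbs N J h (fun σ => |mag N σ ^ 2 / 2 - a|) := by
  have r1 := replace_mag hN J h hij hik hil hjk hjl (fun x y => x * y)
    (fun b c => by simp [abs_mul, spin_abs])
  have r2 := replace_mag hN J h hij hik hil hjk hjl (fun _ _ => 1) (fun b c => by simp)
  simp only [mul_one, ← mul_assoc] at r1 r2
  set D := gibbs N J h (fun σ => |mag N σ ^ 2 / 2 - a|) with hD
  set g := gibbs N J h (fun σ => spin (σ k) * spin (σ l)) with hg
  have hg1 : |g| ≤ 1 := gibbs_abs_le_one (fun σ => by simp [abs_mul, spin_abs])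
  set A := gibbs N J h (fun σ => mag N σ ^ 2 * spin (σ k) * spin (σ l)) with hA
  set B := gibbs N J h (fun σ => mag N σ ^ 2) with hB
  have d1 : |A - 2 * a * g| ≤ 2 * D := by
    rw [hA, hg, hD, ← gibbs_smul, ← gibbs_smul, ← gibbs_sub]
    refine (gibbs_abs_le _ _ _ _).trans (gibbs_mono fun σ => le_of_eq ?_)
    rw [show mag N σ ^ 2 * spin (σ k) * spin (σ l) - 2 * a * (spin (σ k) * spin (σ l))
      = 2 * (mag N σ ^ 2 / 2 - a) * (spin (σ k) * spin (σ l)) by ring]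
    simp [abs_mul, spin_abs]
  have d2 : |B - 2 * a| ≤ 2 * D := by
    rw [hB, hD, ← gibbs_smul, ← gibbs_const N J h (2 * a), ← gibbs_sub]
    refine (gibbs_abs_le _ _ _ _).trans (gibbs_mono fun σ => le_of_eq ?_)
    rw [show mag N σ ^ 2 - 2 * a = 2 * (mag N σ ^ 2 / 2 - a) by ring]
    simp [abs_mul]
  generalize gibbs N J h (fun σ => spin (σ i) * spin (σ j) * spin (σ k) * spin (σ l)) = q4 at *
  generalize gibbs N J h (fun σ => spin (σ i) * spin (σ j)) = q2 at *
  have m1 : |(B - q2) * g| ≤ 10 / N := by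
    rw [abs_mul]; exact (mul_le_of_le_one_right (abs_nonneg _) hg1).trans r2
  have m2 : |(B - 2 * a) * g| ≤ 2 * D := by
    rw [abs_mul]; exact (mul_le_of_le_one_right (abs_nonneg _) hg1).trans d2
  have e20 : (20 : ℝ) / N = 10 / N + 10 / N := by ring
  rw [e20]
  rw [abs_le] at *
  constructor <;> nlinarith

/-- For fixed `h`, pairwise distinct sites `i, j, k, l`, and Lebesgue-almost every
`J ∈ [0, ∞)`, the four-point correlation function factorizes into two-point functions
in the thermodynamic limit `N → ∞`. -/
theorem curieWeiss_fourPoint_factorization (h : ℝ) (i j k l : ℕ)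
    (hij : i ≠ j) (hik : i ≠ k) (hil : i ≠ l) (hjk : j ≠ k) (hjl : j ≠ l) (hkl : k ≠ l) :
    ∀ᵐ J ∂((volume : Measure ℝ).restrict (Set.Ici 0)),
      Tendsto (fun N : ℕ =>
          gibbs N J h (fun σ => spinAt N i σ * spinAt N j σ * spinAt N k σ * spinAt N l σ)
            - gibbs N J h (fun σ => spinAt N i σ * spinAt N j σ)
              * gibbs N J h (fun σ => spinAt N k σ * spinAt N l σ))
        atTop (nhds 0) := by
  choose! p hp using (fun J (hJ : (0:ℝ) ≤ J) => pres_tendsto h hJ)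
  have hmono : Monotone (fun J => p (max J 0)) := by
    intro J K hJK
    exact le_of_tendsto_of_tendsto' (hp _ (le_max_right _ _)) (hp _ (le_max_right _ _))
      (fun N => pres_mono h N (max_le_max_right 0 hJK))
  have hae := ae_restrict_of_ae (s := Set.Ici (0:ℝ)) hmono.ae_differentiableAt
  have hne : ∀ᵐ J ∂((volume : Measure ℝ).restrict (Set.Ici 0)), J ≠ 0 :=
    ae_restrict_of_ae (Measure.ae_ne volume 0)
  filter_upwards [hae, hne, ae_restrict_mem measurableSet_Ici] with J hJd hJ0 hJm
  have hJ : 0 < J := lt_of_le_of_ne hJm (Ne.symm hJ0)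
  have hc := concentration (h := h) hJ (fun J => p (max J 0))
    (fun K hK => by simpa [max_eq_left hK.le] using hp K hK.le) hJd.hasDerivAt
  set a := deriv (fun J => p (max J 0)) J
  have hlim : Tendsto (fun N : ℕ => (20 : ℝ) / N
      + 4 * gibbs N J h (fun σ => |mag N σ ^ 2 / 2 - a|)) atTop (nhds 0) := by
    simpa using (tendsto_const_div_atTop_nhds_zero_nat (20 : ℝ)).add (hc.const_mul 4)
  refine squeeze_zero_norm' ?_ hlim
  filter_upwards [eventually_gt_atTop i, eventually_gt_atTop j, eventually_gt_atTop k,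
    eventually_gt_atTop l] with N hi hj hk hl
  simp only [spinAt, hi, hj, hk, hl, dif_pos, Real.norm_eq_abs]
  exact fourPoint_bound (by omega) J h a (by simpa using hij) (by simpa using hik)
    (by simpa using hil) (by simpa using hjk) (by simpa using hjl)
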